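/- arXiv:math/0510094 — 9 statements merged into one kernel-verified Lean document; each statement's English description precedes it below -/
import Mathlib

section
/- Let k ≥ 2 and let d_1,…,d_k ≥ 2 be integers at least one of which is even. Then the grid graph P_{d_1} □ P_{d_2} □ ⋯ □ P_{d_k} (box product of the paths on d_1,…,d_k vertices) has a Hamiltonian cycle. -/
/-- The grid graph $P_{d_1} \square \dots \square P_{d_k}$, the box product of paths on
$d_1, \dots, d_k$ vertices: vertices are tuples with $i$-th coordinate in `Fin (d i)`,
and two vertices are adjacent iff they agree in all but one coordinate and differ by
exactly `1` in that coordinate. -/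
def gridGraphVar (k : ℕ) (d : Fin k → ℕ) : SimpleGraph (∀ i, Fin (d i)) :=
  SimpleGraph.fromRel fun v w =>
    ∃ i, ((w i : ℕ) = (v i : ℕ) + 1) ∧ ∀ j, j ≠ i → v j = w j

namespace List

variable {α β : Type*}

/-- The boustrophedon enumeration of the product of two lists: a copy of `l` for each entry of
the first list, traversed alternately forwards and backwards. -/
def snake : List α → List β → List (α × β)
  | [], _ => []
  | c :: cs, l => l.map (Prod.mk c) ++ snake cs l.reverse

@[simp] theorem mem_snake {cs : List α} {l : List β} {x : α × β} :
    x ∈ snake cs l ↔ x.1 ∈ cs ∧ x.2 ∈ l := by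
  induction cs generalizing l with
  | nil => simp [snake]
  | cons c cs ih =>
    obtain ⟨a, b⟩ := x
    simp only [snake, mem_append, mem_map, ih, mem_reverse, mem_cons, Prod.mk.injEq]
    grind

theorem Nodup.snake {cs : List α} {l : List β} (hcs : cs.Nodup) (hl : l.Nodup) :
    (snake cs l).Nodup := by
  induction cs generalizing l with
  | nil => simp [List.snake]
  | cons c cs ih =>
    rw [nodup_cons] at hcs
    refine (hl.map (Prod.mk_right_injective c)).append (ih hcs.2 (nodup_reverse.2 hl)) ?_
    intro x hx hx'
    obtain ⟨b, -, rfl⟩ := mem_map.1 hx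
    exact hcs.1 (mem_snake.1 hx').1

theorem head?_snake_cons (c : α) (cs : List α) {l : List β} (hl : l ≠ []) :
    (snake (c :: cs) l).head? = l.head?.map (Prod.mk c) := by
  cases l with
  | nil => contradiction
  | cons b l => simp [snake]

theorem getLast?_snake_of_even {cs : List α} (hcs : Even cs.length) {l : List β} (hl : l ≠ []) :
    (snake cs l).getLast? = cs.getLast?.bind fun c => l.head?.map (Prod.mk c) := by
  induction cs using twoStepInduction with
  | nil => rfl
  | singleton c => simp at hcs
  | cons_cons c c' cs ih =>
    have ih := ih (by simpa [Nat.even_add_one] using hcs)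
    simp only [snake, reverse_reverse, getLast?_append, ih]
    rcases cs.eq_nil_or_concat' with rfl | ⟨cs, a, rfl⟩ <;> cases l <;>
      simp_all [List.getLast?_cons]

end List

namespace SimpleGraph

variable {α β : Type*} {G : SimpleGraph α} {H : SimpleGraph β}

/-- The vertices of a Hamiltonian path, listed in order. -/
structure IsHamiltonianList (G : SimpleGraph α) (l : List α) : Prop where
  isChain : l.IsChain G.Adj
  nodup : l.Nodup
  mem : ∀ a, a ∈ l

theorem IsHamiltonianList.map {l : List α} (hl : G.IsHamiltonianList l) {f : G →g H}
    (hf : Function.Bijective f) : H.IsHamiltonianList (l.map f) where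
  isChain := List.isChain_map_of_isChain f (fun _ _ => f.map_adj) hl.isChain
  nodup := hl.nodup.map hf.injective
  mem b := by
    obtain ⟨a, rfl⟩ := hf.surjective b
    exact List.mem_map_of_mem (hl.mem a)

theorem isChain_snake {cs : List α} {l : List β} (hcs : cs.IsChain G.Adj)
    (hl : l.IsChain H.Adj) : (List.snake cs l).IsChain (G □ H).Adj := by
  induction cs generalizing l with
  | nil => exact .nil
  | cons c cs ih =>
    refine List.isChain_append.2 ⟨?_, ih hcs.tail ?_, ?_⟩
    · exact List.isChain_map_of_isChain (Prod.mk c) (fun _ _ => boxProd_adj_right.2) hl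
    · exact List.isChain_reverse.2 (hl.imp fun _ _ => Adj.symm)
    · cases cs with
      | nil => simp [List.snake]
      | cons c' cs =>
        rcases eq_or_ne l [] with rfl | hne
        · simp
        · rw [List.head?_snake_cons _ _ (by simpa using hne), List.head?_reverse,
            List.getLast?_map]
          rw [List.isChain_cons_cons] at hcs
          cases l.getLast? <;> simp [hcs.1]

theorem IsHamiltonianList.snake {cs : List α} {l : List β} (hcs : G.IsHamiltonianList cs)
    (hl : H.IsHamiltonianList l) : (G □ H).IsHamiltonianList (List.snake cs l) where
  isChain := isChain_snake hcs.isChain hl.isChain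
  nodup := hcs.nodup.snake hl.nodup
  mem x := List.mem_snake.2 ⟨hcs.mem x.1, hl.mem x.2⟩

theorem isHamiltonianList_finRange (n : ℕ) : (pathGraph n).IsHamiltonianList (List.finRange n) where
  isChain := by
    rw [List.isChain_iff_getElem]
    intro i hi
    simp [pathGraph_adj]
  nodup := List.nodup_finRange n
  mem := List.mem_finRange

/-- A Hamiltonian list with at least three entries whose ends are adjacent closes up to a
Hamiltonian cycle. -/
theorem IsHamiltonianList.exists_isHamiltonianCycle [DecidableEq α] {l : List α}
    (hl : G.IsHamiltonianList l) (hlen : 3 ≤ l.length)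
    (hadj : ∀ x ∈ l.getLast?, ∀ y ∈ l.head?, G.Adj x y) :
    ∃ (v : α) (p : G.Walk v v), p.IsHamiltonianCycle := by
  have hne : l ≠ [] := by rintro rfl; simp at hlen
  have hchain : (l.getLast hne :: l).IsChain G.Adj :=
    List.isChain_cons.2 ⟨hadj _ (List.getLast?_eq_getLast_of_ne_nil hne), hl.isChain⟩
  let p : G.Walk (l.getLast hne) (l.getLast hne) :=
    (Walk.ofSupport _ (List.cons_ne_nil _ _) hchain).copy rfl (List.getLast_cons hne)
  have hp : p.support = l.getLast hne :: l :=
    (Walk.support_copy _ _ _).trans (Walk.support_ofSupport _ _)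
  have hplen : 3 ≤ p.length := by
    have := p.length_support
    simp only [hp, List.length_cons] at this
    omega
  have hnil : ¬ p.Nil := by
    rw [Walk.not_nil_iff_lt_length]; omega
  refine ⟨_, p, ?_⟩
  rw [Walk.isHamiltonianCycle_iff_isCycle_and_support_count_tail_eq_one, hp, List.tail_cons]
  refine ⟨Walk.isCycle_iff_isPath_tail_and_le_length.2 ⟨Walk.IsPath.mk' ?_, hplen⟩, fun a => ?_⟩
  · rw [Walk.support_tail_of_not_nil _ hnil, hp]
    exact hl.nodup
  · exact List.count_eq_one_of_mem hl.nodup (hl.mem a)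

/-- Go back and forth over all rows but the first one, then return along the first row. -/
theorem exists_isHamiltonianCycle_boxProd [DecidableEq α] [DecidableEq β] [Nonempty α]
    [Nontrivial β] {cs : List α} {l : List β} (hcs : G.IsHamiltonianList cs)
    (hl : H.IsHamiltonianList l) (heven : Even cs.length) :
    ∃ (v : α × β) (p : (G □ H).Walk v v), p.IsHamiltonianCycle := by
  obtain ⟨c, c', cs, rfl⟩ : ∃ c c' cs', cs = c :: c' :: cs' := by
    match cs, heven, hcs with
    | [], _, h => simpa using h.mem (Classical.arbitrary α)
    | [_], h, _ => simp at h
    | c :: c' :: cs, _, _ => exact ⟨c, c', cs, rfl⟩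
  obtain ⟨b, b', l, rfl⟩ : ∃ b b' l', l = b :: b' :: l' := by
    obtain ⟨x, y, hxy⟩ := exists_pair_ne β
    match l, hl with
    | [], h => simpa using h.mem x
    | [b], h => exact (hxy ((List.mem_singleton.1 (h.mem x)).trans
        (List.mem_singleton.1 (h.mem y)).symm)).elim
    | b :: b' :: l, _ => exact ⟨b, b', l, rfl⟩
  set C := c :: c' :: cs with hC
  have hbb : H.Adj b b' := hl.isChain.rel
  have hnd := List.nodup_cons.1 hl.nodup
  have hlist : (G □ H).IsHamiltonianList
      (List.snake C (b' :: l) ++ C.reverse.map fun a => (a, b)) := by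
    refine ⟨List.isChain_append.2 ⟨isChain_snake hcs.isChain hl.isChain.tail, ?_, ?_⟩, ?_, ?_⟩
    · exact List.isChain_map_of_isChain (fun a => (a, b)) (fun _ _ => boxProd_adj_left.2)
        (List.isChain_reverse.2 (hcs.isChain.imp fun _ _ => Adj.symm))
    · rw [List.getLast?_snake_of_even heven (by simp), List.head?_map, List.head?_reverse]
      cases C.getLast? <;> simp [hbb.symm]
    · refine (hcs.nodup.snake hnd.2).append ?_ ?_
      · exact (List.nodup_reverse.2 hcs.nodup).map (Prod.mk_left_injective b)
      · intro x hx hx'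
        obtain ⟨a, -, rfl⟩ := List.mem_map.1 hx'
        exact hnd.1 (List.mem_snake.1 hx).2
    · rintro ⟨x, y⟩
      have hx := hcs.mem x
      have hy := hl.mem y
      simp only [List.mem_append, List.mem_snake, List.mem_map, List.mem_reverse,
        Prod.mk.injEq]
      grind
  refine hlist.exists_isHamiltonianCycle ?_ ?_
  · simp [hC, List.snake]; omega
  · rw [List.getLast?_append, List.getLast?_map, List.getLast?_reverse]
    simp [hC, List.snake, hbb]

end SimpleGraph

theorem gridGraphVar_adj {k : ℕ} {d : Fin k → ℕ} {v w : ∀ i, Fin (d i)} :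
    (gridGraphVar k d).Adj v w ↔
      ∃ i, (SimpleGraph.pathGraph (d i)).Adj (v i) (w i) ∧ ∀ j, j ≠ i → v j = w j := by
  simp only [gridGraphVar, SimpleGraph.fromRel_adj, SimpleGraph.pathGraph_adj]
  constructor
  · rintro ⟨-, ⟨i, h, hj⟩ | ⟨i, h, hj⟩⟩
    · exact ⟨i, .inl h.symm, hj⟩
    · exact ⟨i, .inr h.symm, fun j hji => (hj j hji).symm⟩
  · rintro ⟨i, h, hj⟩
    refine ⟨fun hvw => by subst hvw; omega, ?_⟩
    rcases h with h | h
    · exact .inl ⟨i, h.symm, hj⟩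
    · exact .inr ⟨i, h.symm, fun j hji => (hj j hji).symm⟩

/-- Splitting off the coordinate `i` of a grid graph. -/
def boxProdHomGridGraphVar {k : ℕ} (d : Fin (k + 1) → ℕ) (i : Fin (k + 1)) :
    (SimpleGraph.pathGraph (d i)).boxProd (gridGraphVar k fun j => d (i.succAbove j)) →g
      gridGraphVar (k + 1) d where
  toFun := Fin.insertNthEquiv (fun j => Fin (d j)) i
  map_rel' := by
    rintro ⟨a, v⟩ ⟨b, w⟩ h
    rw [SimpleGraph.boxProd_adj] at h
    rw [gridGraphVar_adj]
    rcases h with ⟨h, hvw⟩ | ⟨h, hab⟩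
    · obtain rfl : v = w := hvw
      refine ⟨i, by simpa using h, fun j hj => ?_⟩
      obtain ⟨j, rfl⟩ := Fin.exists_succAbove_eq hj
      simp
    · obtain rfl : a = b := hab
      obtain ⟨j, hj, hvw⟩ := gridGraphVar_adj.1 h
      refine ⟨i.succAbove j, by simpa using hj, ?_⟩
      rw [i.forall_iff_succAbove]
      exact ⟨fun _ => by simp, fun m hm => by simpa using hvw m (by rintro rfl; exact hm rfl)⟩

theorem bijective_boxProdHomGridGraphVar {k : ℕ} (d : Fin (k + 1) → ℕ) (i : Fin (k + 1)) :
    Function.Bijective (boxProdHomGridGraphVar d i) :=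
  (Fin.insertNthEquiv (fun j => Fin (d j)) i).bijective

theorem exists_isHamiltonianList_gridGraphVar (k : ℕ) (d : Fin k → ℕ) :
    ∃ l, (gridGraphVar k d).IsHamiltonianList l := by
  induction k with
  | zero => exact ⟨[default], .singleton _, List.nodup_singleton _, fun a => by
      simp [Subsingleton.elim a default]⟩
  | succ k ih =>
    obtain ⟨l, hl⟩ := ih fun j => d (Fin.succAbove 0 j)
    exact ⟨_, ((SimpleGraph.isHamiltonianList_finRange (d 0)).snake hl).map
      (bijective_boxProdHomGridGraphVar d 0)⟩

/-- If `k ≥ 2`, each `d i ≥ 2`, and at least one `d i` is even, then the grid graph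
$P_{d_1} \square \dots \square P_{d_k}$ has a Hamiltonian cycle. -/
theorem gridVar_hamiltonian (k : ℕ) (d : Fin k → ℕ) (hk : 2 ≤ k)
    (hd : ∀ i, 2 ≤ d i) (he : ∃ i, Even (d i)) :
    ∃ (v : ∀ i, Fin (d i)) (p : (gridGraphVar k d).Walk v v), p.IsHamiltonianCycle := by
  obtain ⟨k, rfl⟩ : ∃ n, k = n + 2 := ⟨k - 2, by omega⟩
  obtain ⟨i, hi⟩ := he
  obtain ⟨l, hl⟩ := exists_isHamiltonianList_gridGraphVar (k + 1) fun j => d (i.succAbove j)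
  have (j : Fin (k + 2)) : Nontrivial (Fin (d j)) := Fin.nontrivial_iff_two_le.2 (hd j)
  obtain ⟨v, p, hp⟩ := SimpleGraph.exists_isHamiltonianCycle_boxProd
    (SimpleGraph.isHamiltonianList_finRange (d i)) hl (by simpa using hi)
  exact ⟨_, _, hp.map (bijective_boxProdHomGridGraphVar d i)⟩
end

section
/- For all integers k ≥ 2, d ≥ 2 and 1 ≤ s ≤ k−1, the alphabet overlap graph G(k,d,s) has a Hamiltonian cycle. -/
/-- The alphabet overlap graph `G(k,d,s)`: vertices are words of length `k` over an
alphabet of size `d`; distinct words `v, w` are adjacent iff the last `k - s` letters of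
`v` equal the first `k - s` letters of `w`, or vice versa. -/
def AOGraph (k d s : ℕ) : SimpleGraph (Fin k → Fin d) :=
  SimpleGraph.fromRel fun v w =>
    ∀ i : Fin (k - s), v ⟨s + i.val, by have := i.isLt; omega⟩
      = w ⟨i.val, by have := i.isLt; omega⟩

open Equiv.Perm in
/-- Composing a permutation with a transposition of points in different cycles merges these
two cycles. -/
theorem Equiv.Perm.sameCycle_mul_swap_of_not_sameCycle {V : Type*} [Finite V] [DecidableEq V]
    {σ : Equiv.Perm V} {v w : V} (hvw : ¬ σ.SameCycle v w) :
    (σ * Equiv.swap v w).SameCycle v w ∧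
      ∀ x, σ.SameCycle v x → (σ * Equiv.swap v w).SameCycle v x := by
  set τ := σ * Equiv.swap v w with hτ
  have hτw : τ w = σ v := by simp [hτ]
  have key (i : ℕ) : τ.SameCycle w ((σ ^ (i + 1)) v) := by
    induction i with
    | zero =>
      rw [zero_add, pow_one, ← hτw]
      exact sameCycle_apply_right.2 .rfl
    | succ i ih =>
      rw [pow_succ', mul_apply]
      set y := (σ ^ (i + 1)) v with hy
      by_cases hyv : y = v
      · rw [hyv, ← hτw]
        exact sameCycle_apply_right.2 .rfl
      · have hyw : y ≠ w := fun h => hvw ⟨(i + 1 : ℕ), by rw [zpow_natCast, ← hy, h]⟩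
        have : τ y = σ y := by simp [hτ, Equiv.swap_apply_of_ne_of_ne hyv hyw]
        rw [← this]
        exact sameCycle_apply_right.2 ih
  have hall (x : V) (hx : σ.SameCycle v x) : τ.SameCycle w x := by
    obtain ⟨i, hi, -, rfl⟩ := hx.exists_pow_eq''
    obtain ⟨j, rfl⟩ := Nat.exists_eq_add_of_le' hi
    exact key j
  have hwv : τ.SameCycle w v := hall v .rfl
  exact ⟨hwv.symm, fun x hx => hwv.symm.trans (hall x hx)⟩

/-- Consider the digraph with an arc `v → w` whenever `q v = p w`. If its arcs admit a cycle cover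
`σ` and every vertex is reachable from every other one, then it has a cycle cover consisting of
a single cycle. -/
theorem exists_perm_forall_sameCycle {V M : Type*} [Finite V] (p q : V → M) (σ : Equiv.Perm V)
    (hσ : ∀ v, p (σ v) = q v)
    (hconn : ∀ v w, Relation.ReflTransGen (fun v w => q v = p w) v w) :
    ∃ τ : Equiv.Perm V, (∀ v, p (τ v) = q v) ∧ ∀ v w, τ.SameCycle v w := by
  classical
  rcases isEmpty_or_nonempty V with hV | ⟨⟨a⟩⟩
  · exact ⟨σ, hσ, fun v => hV.elim v⟩
  obtain ⟨τ, hτ, hmax⟩ := Set.exists_max_image {τ : Equiv.Perm V | ∀ v, p (τ v) = q v}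
    (fun τ => {x | τ.SameCycle a x}.ncard) (Set.toFinite _) ⟨σ, hσ⟩
  refine ⟨τ, hτ, ?_⟩
  have hfiber (v w : V) (hv : τ.SameCycle a v) (hq : q w = q v) : τ.SameCycle a w := by
    by_contra hw
    have hvw : ¬ τ.SameCycle v w := fun h => hw (hv.trans h)
    obtain ⟨h₁, h₂⟩ := Equiv.Perm.sameCycle_mul_swap_of_not_sameCycle hvw
    have hav := (h₂ a hv.symm).symm
    refine (Set.ncard_lt_ncard ?_ (Set.toFinite _)).not_ge
      (hmax (τ * Equiv.swap v w) fun x => ?_)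
    · exact (Set.ssubset_iff_of_subset fun x hx => hav.trans (h₂ x (hv.symm.trans hx))).2
        ⟨w, hav.trans h₁, hw⟩
    · rw [Equiv.Perm.mul_apply, hτ, Equiv.swap_apply_def]
      split_ifs with h h
      · rw [h, hq]
      · rw [h, hq]
      · rfl
  have hreach (w : V) : τ.SameCycle a w := by
    induction hconn a w with
    | refl => exact .rfl
    | @tail v w _ hvw ih =>
      obtain ⟨u, rfl⟩ := τ.surjective w
      exact Equiv.Perm.sameCycle_apply_right.2 (hfiber v u ih (by rw [hvw, hτ]))
  exact fun v w => (hreach v).symm.trans (hreach w)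

open SimpleGraph in
/-- The closed walk around `cycleGraph (n + 3)` is a Hamiltonian cycle. -/
theorem SimpleGraph.cycleGraph.isHamiltonianCycle_cycle (n : ℕ) :
    (cycleGraph.cycle n).IsHamiltonianCycle :=
  Walk.isHamiltonianCycle_iff_isCycle_and_length_eq.2 ⟨isCycle_cycle, by simp⟩

/-- A graph on at least three vertices with a cyclic permutation of all vertices along its edges
has a Hamiltonian cycle. -/
theorem SimpleGraph.exists_isHamiltonianCycle_of_sameCycle {V : Type*} [Fintype V] [DecidableEq V]
    {G : SimpleGraph V} (hV : 3 ≤ Fintype.card V) (σ : Equiv.Perm V)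
    (hσ : ∀ v w, σ.SameCycle v w) (hadj : ∀ v, G.Adj v (σ v)) :
    ∃ (v : V) (p : G.Walk v v), p.IsHamiltonianCycle := by
  obtain ⟨n, hn⟩ := Nat.exists_eq_add_of_le' hV
  obtain ⟨a⟩ : Nonempty V := Fintype.card_pos_iff.1 (by omega)
  have hon : σ.IsCycleOn ((Finset.univ : Finset V) : Set V) :=
    ⟨by simp, fun v _ w _ => hσ v w⟩
  have hpow {i j : ℕ} : (σ ^ i) a = (σ ^ j) a ↔ i ≡ j [MOD n + 3] := by
    rw [← hn, ← Finset.card_univ]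
    exact hon.pow_apply_eq_pow_apply (Finset.mem_univ a)
  let g : Fin (n + 3) → V := fun i => (σ ^ (i : ℕ)) a
  have hg (i j : Fin (n + 3)) (h : j - i = 1) : G.Adj (g i) (g j) := by
    have : g j = σ (g i) := by
      rw [← Equiv.Perm.mul_apply, ← pow_succ']
      obtain rfl : j = i + 1 := by rw [← h]; abel
      refine hpow.2 ?_
      simp [Nat.ModEq, Fin.val_add]
    rw [this]
    exact hadj _
  let f : cycleGraph (n + 3) →g G := ⟨g, fun {i j} h => by
    rcases cycleGraph_adj.1 h with h | h
    · exact (hg _ _ h).symm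
    · exact hg _ _ h⟩
  have hf : Function.Bijective f := by
    refine (Fintype.bijective_iff_injective_and_card f).2 ⟨fun i j hij => ?_, by simp [hn]⟩
    exact Fin.ext ((hpow.1 hij).eq_of_lt_of_lt i.isLt j.isLt)
  exact ⟨_, _, (cycleGraph.isHamiltonianCycle_cycle n).map hf⟩

/-- Any two words are joined by a sequence of words in which each one begins with the last `k - s`
letters of its predecessor. -/
theorem reflTransGen_overlap {A : Type*} {k s : ℕ} (hs : 1 ≤ s) (v w : Fin k → A) :
    Relation.ReflTransGen (fun v w : Fin k → A =>
      (fun i : Fin (k - s) => v ⟨s + i.val, by omega⟩) = fun i => w ⟨i.val, by omega⟩) v w := by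
  rcases Nat.eq_zero_or_pos k with rfl | hk
  · rw [Subsingleton.elim v w]
  let x : ℕ → A := fun i => if h : i < k then v ⟨i, h⟩ else w ⟨(i - k * s) % k, Nat.mod_lt _ hk⟩
  let u : ℕ → Fin k → A := fun j i => x (j * s + i)
  have hv : u 0 = v := by
    ext i
    simp [u, x]
  have hw : u k = w := by
    ext i
    have : k ≤ k * s := Nat.le_mul_of_pos_right k hs
    have h : ¬ k * s + i < k := by omega
    simp [u, x, h, Nat.mod_eq_of_lt i.isLt]
  have hu (j : ℕ) : Relation.ReflTransGen (fun v w : Fin k → A =>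
      (fun i : Fin (k - s) => v ⟨s + i.val, by omega⟩) = fun i => w ⟨i.val, by omega⟩)
      (u 0) (u j) := by
    induction j with
    | zero => exact .refl
    | succ j ih =>
      refine ih.tail (funext fun i => ?_)
      simp only [u]
      congr 1
      ring
  rw [← hv, ← hw]
  exact hu k

/-- For all `k ≥ 2`, `d ≥ 2` and `1 ≤ s ≤ k - 1`, the alphabet overlap graph
`G(k, d, s)` has a Hamiltonian cycle. -/
theorem aoGraph_hamiltonian (k d s : ℕ) (hk : 2 ≤ k) (hd : 2 ≤ d)
    (hs1 : 1 ≤ s) (hs2 : s ≤ k - 1) :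
    ∃ (v : Fin k → Fin d) (p : (AOGraph k d s).Walk v v), p.IsHamiltonianCycle := by
  have : NeZero k := ⟨by omega⟩
  have hcard : 3 ≤ Fintype.card (Fin k → Fin d) := by
    have : 2 ^ 2 ≤ d ^ k := (Nat.pow_le_pow_left hd 2).trans (Nat.pow_le_pow_right (by omega) hk)
    rw [Fintype.card_fun, Fintype.card_fin, Fintype.card_fin]
    omega
  obtain ⟨τ, hτ, hcyc⟩ := exists_perm_forall_sameCycle
    (fun (w : Fin k → Fin d) (i : Fin (k - s)) => w ⟨i.val, by omega⟩)
    (fun v i => v ⟨s + i.val, by omega⟩)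
    (Equiv.arrowCongr (Equiv.subRight (⟨s, by omega⟩ : Fin k)) (Equiv.refl _))
    (fun v => funext fun i => by
      have hi := i.isLt
      simp only [Equiv.arrowCongr_apply, Function.comp_apply, Equiv.refl_apply,
        Equiv.subRight_symm_apply]
      congr 1
      rw [Fin.ext_iff, Fin.val_add, Nat.mod_eq_of_lt (by simp only; omega), add_comm])
    (reflTransGen_overlap hs1)
  refine SimpleGraph.exists_isHamiltonianCycle_of_sameCycle hcard τ hcyc fun v => ?_
  have hne : v ≠ τ v := fun h => by
    have : Nontrivial (Fin k → Fin d) := Fintype.one_lt_card_iff_nontrivial.1 (by omega)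
    obtain ⟨w, hw⟩ := exists_ne v
    exact hw ((hcyc v w).eq_of_left h.symm).symm
  exact (SimpleGraph.fromRel_adj _ _ _).2 ⟨hne, .inl fun i => (congrFun (hτ v) i).symm⟩
end

section
/- Let d ≥ 2, k ≥ 2, and let s satisfy k/2 ≤ s ≤ k−1; write t = k−s. Fix a word t* of length t and consider the set of all words of the form t* w t*, where w ranges over all words of length k−2t (all such words begin and end with t*). This set of d^{k−2t} vertices forms a clique in the alphabet overlap graph G(k,d,s). -/
/-- The word `t* w t*` obtained by putting the tag `t*` on both sides of `w`. -/
def taggedWord {k d s : ℕ} (tstar : Fin (k - s) → Fin d)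
    (w : Fin (k - 2 * (k - s)) → Fin d) (i : Fin k) : Fin d :=
  if h₁ : i.val < k - s then tstar ⟨i.val, h₁⟩
  else if h₂ : i.val < s then w ⟨i.val - (k - s), by omega⟩
  else tstar ⟨i.val - s, by omega⟩

theorem taggedWord_injective {k d s : ℕ} (tstar : Fin (k - s) → Fin d) :
    Function.Injective (taggedWord tstar) := by
  intro w w' h
  funext j
  have hj := j.isLt
  have h₁ : ¬ j.val + (k - s) < k - s := by omega
  have h₂ : j.val + (k - s) < s := by omega
  have := congrFun h ⟨j.val + (k - s), by omega⟩
  simpa [taggedWord, h₁, h₂] using this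

theorem range_taggedWord {k d s : ℕ} (hs : k ≤ 2 * s) (tstar : Fin (k - s) → Fin d) :
    Set.range (taggedWord tstar) =
      {v : Fin k → Fin d |
        (∀ i : Fin (k - s), v ⟨i.val, by have := i.isLt; omega⟩ = tstar i) ∧
        (∀ i : Fin (k - s), v ⟨s + i.val, by have := i.isLt; omega⟩ = tstar i)} := by
  ext v
  constructor
  · rintro ⟨w, rfl⟩
    refine ⟨fun i => by simp [taggedWord], fun i => ?_⟩
    have hi := i.isLt
    have h₁ : ¬ s + i.val < k - s := by omega
    simp [taggedWord, h₁]
  · rintro ⟨hpre, hsuf⟩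
    refine ⟨fun j => v ⟨j.val + (k - s), by omega⟩, ?_⟩
    funext i
    unfold taggedWord
    split_ifs with h₁ h₂
    · exact (hpre ⟨i.val, h₁⟩).symm
    · exact congrArg v (Fin.ext (Nat.sub_add_cancel (not_lt.1 h₁)))
    · rw [← hsuf]
      exact congrArg v (Fin.ext (Nat.add_sub_cancel' (not_lt.1 h₂)))

/-- For `d ≥ 2`, `k ≥ 2`, `k/2 ≤ s ≤ k - 1` and `t = k - s`: for any fixed tag
`t*` of length `t`, the set of all words of the form `t* w t*` (i.e. beginning and
ending with `t*`) is a clique in `G(k, d, s)` of cardinality `d^(k - 2t)`. -/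
theorem aoGraph_clique (k d s : ℕ) (hd : 2 ≤ d) (hk : 2 ≤ k)
    (hs1 : k ≤ 2 * s) (hs2 : s ≤ k - 1) (tstar : Fin (k - s) → Fin d) :
    (AOGraph k d s).IsClique
      {v : Fin k → Fin d |
        (∀ i : Fin (k - s), v ⟨i.val, by have := i.isLt; omega⟩ = tstar i) ∧
        (∀ i : Fin (k - s), v ⟨s + i.val, by have := i.isLt; omega⟩ = tstar i)} ∧
    Set.ncard
      {v : Fin k → Fin d |
        (∀ i : Fin (k - s), v ⟨i.val, by have := i.isLt; omega⟩ = tstar i) ∧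
        (∀ i : Fin (k - s), v ⟨s + i.val, by have := i.isLt; omega⟩ = tstar i)}
      = d ^ (k - 2 * (k - s)) := by
  constructor
  · rintro v ⟨hv, -⟩ w ⟨-, hw⟩ hne
    exact (SimpleGraph.fromRel_adj _ _ _).2
      ⟨hne, Or.inr fun i => (hw i).trans (hv i).symm⟩
  · rw [← range_taggedWord hs1, ← Set.image_univ,
      Set.ncard_image_of_injective _ (taggedWord_injective tstar), Set.ncard_univ]
    simp
end

section
/- Let d ≥ 2, k ≥ 3, and let s satisfy 1 ≤ s < k/2; write t = k−s (so t > k/2). Then the chromatic number of the alphabet overlap graph G(k,d,s) is at most 1 + d^{k−s}. -/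
/-- The initial `k - s` letters of a word of length `k`. -/
def wordPrefix {k d : ℕ} (s : ℕ) (v : Fin k → Fin d) : Fin (k - s) → Fin d :=
  fun i => v ⟨i.val, by have := i.isLt; omega⟩

/-- The final `k - s` letters of a word of length `k`. -/
def wordSuffix {k d : ℕ} (s : ℕ) (v : Fin k → Fin d) : Fin (k - s) → Fin d :=
  fun i => v ⟨s + i.val, by have := i.isLt; omega⟩

/-- If prefix and suffix together cover all positions, they determine the word. -/
theorem eq_of_wordPrefix_eq_of_wordSuffix_eq {k d s : ℕ} (hs : 2 * s ≤ k)
    {v w : Fin k → Fin d} (hp : wordPrefix s v = wordPrefix s w)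
    (hq : wordSuffix s v = wordSuffix s w) : v = w := by
  funext i
  by_cases h : i.val < k - s
  · exact congrFun hp ⟨i, h⟩
  · have hi := congrFun hq ⟨i - s, by omega⟩
    have e : s + (i.val - s) = i.val := by omega
    simpa only [wordSuffix, e] using hi

/-- Colour a word by its prefix, except that all words whose prefix and suffix coincide
share one extra colour. -/
def overlapColor {k d : ℕ} (s : ℕ) (v : Fin k → Fin d) : Option (Fin (k - s) → Fin d) :=
  if wordPrefix s v = wordSuffix s v then none else some (wordPrefix s v)

theorem overlapColor_ne {k d s : ℕ} (hs : 2 * s ≤ k) {v w : Fin k → Fin d} (hne : v ≠ w)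
    (h : wordSuffix s v = wordPrefix s w) : overlapColor s v ≠ overlapColor s w := by
  intro heq
  unfold overlapColor at heq
  split_ifs at heq with hv hw
  · exact hne (eq_of_wordPrefix_eq_of_wordSuffix_eq hs (hv.trans h) (h.trans hw))
  · exact hv ((Option.some.inj heq).trans h.symm)

/-- For `d ≥ 2`, `k ≥ 3` and `1 ≤ s < k/2` (tag length `t = k - s > k/2`), the
chromatic number of `G(k, d, s)` is at most `1 + d^(k - s)`. -/
theorem aoGraph_chromaticNumber_le (k d s : ℕ) (hd : 2 ≤ d) (hk : 3 ≤ k)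
    (hs1 : 1 ≤ s) (hs2 : 2 * s < k) :
    (AOGraph k d s).chromaticNumber ≤ (1 + d ^ (k - s) : ℕ) := by
  let C : (AOGraph k d s).Coloring (Option (Fin (k - s) → Fin d)) :=
    SimpleGraph.Coloring.mk (overlapColor s) fun {v w} hadj => by
      obtain ⟨hne, h | h⟩ := (SimpleGraph.fromRel_adj _ v w).mp hadj
      · exact overlapColor_ne hs2.le hne (funext h)
      · exact (overlapColor_ne hs2.le hne.symm (funext h)).symm
  have hcard : Fintype.card (Option (Fin (k - s) → Fin d)) = 1 + d ^ (k - s) := by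
    simp [add_comm]
  exact hcard ▸ C.colorable.chromaticNumber_le
end

section
/- Let d ≥ 1, k ≥ 3, and let s satisfy 1 ≤ s < k/2; write t = k−s (so k/2 < t < k). Then there is a graph embedding of the alphabet overlap graph G(k,d,s) into the alphabet overlap graph G(2t,d,t): the map sending a word u = x m z (where x and z have length k−t = s and m has length 2t−k) to the word x m m z of length 2t is injective, and two words of G(k,d,s) are adjacent if and only if their images are adjacent in G(2t,d,t). -/
/-- For `d ≥ 1`, `k ≥ 3` and `1 ≤ s < k/2`, writing `t = k - s`: the map sending a
word `u = x m z` (with `x, z` of length `s` and `m` of length `2t - k`) to the word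
`x m m z` of length `2t` is injective, and two words are adjacent in `G(k, d, s)` iff
their images are adjacent in `G(2t, d, t)`; i.e. it is a graph embedding. -/
theorem aoGraph_embedding (k d s : ℕ) (hd : 1 ≤ d) (hk : 3 ≤ k)
    (hs1 : 1 ≤ s) (hs2 : 2 * s < k) :
    ∃ f : (Fin k → Fin d) → (Fin (2 * (k - s)) → Fin d),
      (∀ (u : Fin k → Fin d) (j : Fin (2 * (k - s))),
        f u j = if h : (j : ℕ) < k - s
          then u ⟨j, by have := j.isLt; omega⟩
          else u ⟨(j : ℕ) - (k - 2 * s), by have := j.isLt; omega⟩) ∧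
      Function.Injective f ∧
      ∀ u v : Fin k → Fin d,
        (AOGraph k d s).Adj u v ↔ (AOGraph (2 * (k - s)) d (k - s)).Adj (f u) (f v) := by
  let f : (Fin k → Fin d) → (Fin (2 * (k - s)) → Fin d) := fun u j =>
    if h : (j : ℕ) < k - s
      then u ⟨j, by have := j.isLt; omega⟩
      else u ⟨(j : ℕ) - (k - 2 * s), by have := j.isLt; omega⟩
  have f_prefix (u : Fin k → Fin d) (i : ℕ) (hi : i < k - s) :
      f u ⟨i, by omega⟩ = u ⟨i, by omega⟩ := dif_pos hi
  have f_suffix (u : Fin k → Fin d) (i : ℕ) (hi : i < k - s) :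
      f u ⟨k - s + i, by omega⟩ = u ⟨s + i, by omega⟩ := by
    have h : ¬ k - s + i < k - s := by omega
    refine (dif_neg h).trans (congrArg u (Fin.ext ?_))
    change k - s + i - (k - 2 * s) = s + i
    omega
  have f_injective : Function.Injective f := by
    intro u v huv
    ext1 ⟨i, hi⟩
    by_cases h : i < k - s
    · rw [← f_prefix u i h, ← f_prefix v i h, huv]
    · obtain ⟨j, rfl⟩ : ∃ j, i = s + j := ⟨i - s, by omega⟩
      have hj : j < k - s := by omega
      rw [← f_suffix u j hj, ← f_suffix v j hj, huv]
  have overlap_iff (u v : Fin k → Fin d) :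
      (∀ i : Fin (k - s), u ⟨s + i.val, by have := i.isLt; omega⟩
        = v ⟨i.val, by have := i.isLt; omega⟩) ↔
      ∀ i : Fin (2 * (k - s) - (k - s)),
        f u ⟨k - s + i.val, by have := i.isLt; omega⟩
          = f v ⟨i.val, by have := i.isLt; omega⟩ := by
    constructor
    · rintro h ⟨i, hi⟩
      have hi' : i < k - s := by omega
      exact (f_suffix u i hi').trans ((h ⟨i, hi'⟩).trans (f_prefix v i hi').symm)
    · rintro h ⟨i, hi⟩
      exact (f_suffix u i hi).symm.trans ((h ⟨i, by omega⟩).trans (f_prefix v i hi))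
  refine ⟨f, fun _ _ => rfl, f_injective, fun u v => ?_⟩
  simp only [AOGraph, SimpleGraph.fromRel_adj, f_injective.ne_iff]
  rw [overlap_iff u v, overlap_iff v u]
end

section
/- Let d ≥ 2, k ≥ 3, and let s satisfy 1 ≤ s < k/2; write t = k−s (so k/2 < t < k). Then χ(G(k,d,s)) ≤ 1 + χ(G(t,d,k−t)), where G(t,d,k−t) is the alphabet overlap graph on words of length t with overlap parameter k−t. -/
namespace AOGraph

variable {k d s : ℕ}

/-- The first `k - s` letters of a word of length `k`. -/
def wordPrefix (s : ℕ) (v : Fin k → Fin d) : Fin (k - s) → Fin d :=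
  fun i => v ⟨i, by omega⟩

/-- The last `k - s` letters of a word of length `k`. -/
def wordSuffix (s : ℕ) (v : Fin k → Fin d) : Fin (k - s) → Fin d :=
  fun i => v ⟨s + i, by omega⟩

theorem adj_iff {v w : Fin k → Fin d} :
    (AOGraph k d s).Adj v w ↔
      v ≠ w ∧ (wordSuffix s v = wordPrefix s w ∨ wordSuffix s w = wordPrefix s v) := by
  simp only [AOGraph, SimpleGraph.fromRel_adj, wordSuffix, wordPrefix, funext_iff]

theorem adj_wordPrefix_wordSuffix {v : Fin k → Fin d} (h : wordPrefix s v ≠ wordSuffix s v) :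
    (AOGraph (k - s) d s).Adj (wordPrefix s v) (wordSuffix s v) :=
  adj_iff.2 ⟨h, Or.inl rfl⟩

theorem ext_wordPrefix_wordSuffix (hs : 2 * s ≤ k) {v w : Fin k → Fin d}
    (hp : wordPrefix s v = wordPrefix s w) (hq : wordSuffix s v = wordSuffix s w) : v = w := by
  funext i
  by_cases hi : i.val < k - s
  · exact congrFun hp ⟨i, hi⟩
  · have h := congrFun hq ⟨i - s, by omega⟩
    have hi' : s + (i.val - s) = i := by omega
    simpa only [wordSuffix, hi'] using h

/-- A coloring of `G(k - s, d, s)` colors `G(k, d, s)` with one extra color: a word takes the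
color of its prefix, unless its prefix and suffix coincide, when it takes the extra color. -/
def coloringOption {α : Type*} (hs : 2 * s ≤ k) (C : (AOGraph (k - s) d s).Coloring α) :
    (AOGraph k d s).Coloring (Option α) :=
  SimpleGraph.Coloring.mk
    (fun v => if wordPrefix s v = wordSuffix s v then none else some (C (wordPrefix s v))) <| by
    have key : ∀ v w : Fin k → Fin d, v ≠ w → wordSuffix s v = wordPrefix s w →
        (if wordPrefix s v = wordSuffix s v then none else some (C (wordPrefix s v))) ≠
          if wordPrefix s w = wordSuffix s w then none else some (C (wordPrefix s w)) := by
      intro v w hne h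
      by_cases hv : wordPrefix s v = wordSuffix s v <;>
        by_cases hw : wordPrefix s w = wordSuffix s w
      · exact absurd (ext_wordPrefix_wordSuffix hs (hv.trans h) (h.trans hw)) hne
      · simp [hv, hw]
      · simp [hv, hw]
      · rw [if_neg hv, if_neg hw, ← h]
        exact fun e => C.valid (adj_wordPrefix_wordSuffix hv) (Option.some.inj e)
    intro v w hvw
    obtain ⟨hne, h | h⟩ := adj_iff.1 hvw
    · exact key v w hne h
    · exact (key w v hne.symm h).symm

end AOGraph

/-- For `d ≥ 2`, `k ≥ 3` and `1 ≤ s < k/2`, writing `t = k - s`: the chromatic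
number of `G(k, d, s)` is at most `1` plus the chromatic number of `G(t, d, k - t)`. -/
theorem aoGraph_chromaticNumber_rec (k d s : ℕ) (hd : 2 ≤ d) (hk : 3 ≤ k)
    (hs1 : 1 ≤ s) (hs2 : 2 * s < k) :
    (AOGraph k d s).chromaticNumber ≤ 1 + (AOGraph (k - s) d s).chromaticNumber := by
  obtain ⟨n, hn⟩ := ENat.ne_top_iff_exists.1
    (SimpleGraph.chromaticNumber_ne_top_iff_exists.2
      ⟨_, (AOGraph (k - s) d s).colorable_of_fintype⟩)
  obtain ⟨C⟩ := SimpleGraph.chromaticNumber_le_iff_colorable.1 hn.ge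
  have h := (AOGraph.coloringOption hs2.le C).colorable.chromaticNumber_le
  rw [← hn, add_comm]
  simpa using h
end

section
/- Let d ≥ 2, k ≥ 2, and let s satisfy k/2 ≤ s ≤ k−1; write t = k−s, and suppose d^t ≥ 4. Then the alphabet overlap graph G(k,d,s) contains a complete bipartite graph K_{3,3} as a subgraph: there exist six distinct words u_1,u_2,u_3,v_1,v_2,v_3 such that u_i is adjacent to v_j for all 1 ≤ i,j ≤ 3. -/
/-- The word of length `k` with first `k - s` letters `a`, last `k - s` letters `b`, and all
letters in between equal to `c`. -/
def tagWord {k d s : ℕ} (c : Fin d) (a b : Fin (k - s) → Fin d) : Fin k → Fin d := fun n =>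
  if h : n.val < k - s then a ⟨n, h⟩
  else if h' : s ≤ n.val then b ⟨n - s, by have := n.isLt; omega⟩
  else c

theorem tagWord_first {k d s : ℕ} (c : Fin d) (a b : Fin (k - s) → Fin d) (i : Fin (k - s)) :
    tagWord c a b ⟨i, by have := i.isLt; omega⟩ = a i := by
  simp [tagWord]

theorem tagWord_last {k d s : ℕ} (hs : k ≤ 2 * s) (c : Fin d) (a b : Fin (k - s) → Fin d)
    (i : Fin (k - s)) : tagWord c a b ⟨s + i, by have := i.isLt; omega⟩ = b i := by
  have h : ¬ s + i.val < k - s := by omega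
  simp [tagWord, h]

theorem tagWord_first_eq {k d s : ℕ} {c : Fin d} {a b a' b' : Fin (k - s) → Fin d}
    (h : tagWord c a b = tagWord c a' b') : a = a' := by
  funext i
  rw [← tagWord_first c a b i, h, tagWord_first]

theorem tagWord_last_eq {k d s : ℕ} (hs : k ≤ 2 * s) {c : Fin d}
    {a b a' b' : Fin (k - s) → Fin d} (h : tagWord c a b = tagWord c a' b') : b = b' := by
  funext i
  rw [← tagWord_last hs c a b i, h, tagWord_last hs]

/-- For `d ≥ 2`, `k ≥ 2`, `k/2 ≤ s ≤ k - 1`, `t = k - s` and `d^t ≥ 4`, the graph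
`G(k, d, s)` contains `K_{3,3}` as a subgraph: there are six distinct words
`u 0, u 1, u 2, v 0, v 1, v 2` with each `u i` adjacent to each `v j`. -/
theorem aoGraph_K33 (k d s : ℕ) (hd : 2 ≤ d) (hk : 2 ≤ k)
    (hs1 : k ≤ 2 * s) (hs2 : s ≤ k - 1) (htag : 4 ≤ d ^ (k - s)) :
    ∃ u v : Fin 3 → (Fin k → Fin d),
      Function.Injective u ∧ Function.Injective v ∧
      (∀ i j, u i ≠ v j) ∧
      ∀ i j, (AOGraph k d s).Adj (u i) (v j) := by
  obtain ⟨e⟩ : Nonempty (Fin 4 ↪ (Fin (k - s) → Fin d)) :=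
    Function.Embedding.nonempty_of_card_le (by simpa using htag)
  let c : Fin d := ⟨0, by omega⟩
  have hne : ∀ i j : Fin 3, tagWord c (e i.castSucc) (e (Fin.last 3)) ≠
      tagWord c (e (Fin.last 3)) (e j.castSucc) := fun i _ h =>
    Fin.castSucc_ne_last i (e.injective (tagWord_first_eq h))
  refine ⟨fun i => tagWord c (e i.castSucc) (e (Fin.last 3)),
    fun j => tagWord c (e (Fin.last 3)) (e j.castSucc), fun i j h => ?_, fun i j h => ?_,
    hne, fun i j => ?_⟩
  · exact Fin.castSucc_injective 3 (e.injective (tagWord_first_eq h))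
  · exact Fin.castSucc_injective 3 (e.injective (tagWord_last_eq hs1 h))
  · exact (SimpleGraph.fromRel_adj _ _ _).mpr
      ⟨hne i j, Or.inl fun l =>
        (tagWord_last hs1 _ _ _ l).trans (tagWord_first _ _ _ l).symm⟩
end

section
/- Let d ≥ 2, k ≥ 2, and let s satisfy k/2 ≤ s ≤ k−1; write t = k−s. Fix any word x of length s. Then the set of all d^t words of the form τx, where τ ranges over all words (tags) of length t, is a dominating set of the alphabet overlap graph G(k,d,s). -/
/-- For `d ≥ 2`, `k ≥ 2`, `k/2 ≤ s ≤ k - 1` and `t = k - s`: for any fixed word `x`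
of length `s`, the set of all `d^t` words of the form `τ x` (tag `τ` of length `t`
followed by `x`) is a dominating set of `G(k, d, s)`. -/
theorem aoGraph_dominatingSet (k d s : ℕ) (hd : 2 ≤ d) (hk : 2 ≤ k)
    (hs1 : k ≤ 2 * s) (hs2 : s ≤ k - 1) (x : Fin s → Fin d) :
    ∀ v : Fin k → Fin d,
      v ∉ {w : Fin k → Fin d |
          ∀ i : Fin s, w ⟨(k - s) + i.val, by have := i.isLt; omega⟩ = x i} →
      ∃ u ∈ {w : Fin k → Fin d |
          ∀ i : Fin s, w ⟨(k - s) + i.val, by have := i.isLt; omega⟩ = x i},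
        (AOGraph k d s).Adj u v := by
  intro v hv
  let u : Fin k → Fin d := fun j =>
    if h : j.val < k - s then v ⟨s + j.val, by omega⟩
    else x ⟨j.val - (k - s), by have := j.isLt; omega⟩
  have hu : ∀ i : Fin s, u ⟨(k - s) + i.val, by have := i.isLt; omega⟩ = x i := by
    intro i
    simp [u]
  refine ⟨u, hu, ?_⟩
  rw [AOGraph, SimpleGraph.fromRel_adj]
  refine ⟨?_, Or.inr fun i => ?_⟩
  · intro h
    exact hv (h ▸ hu)
  · simp [u]
end

section
/- For all integers k ≥ 2 and d ≥ 2, the number of edges of the alphabet overlap graph G(k,d,1) equals d^{k+1} − d(d+1)/2. -/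
open Finset in
/-- Pairs of words whose overlap has full length but one are the two windows of a longer word. -/
theorem card_shift_pairs (n d : ℕ) :
    #{p : (Fin (n + 1) → Fin d) × (Fin (n + 1) → Fin d) |
      ∀ i : Fin n, p.1 i.succ = p.2 i.castSucc} = d ^ (n + 2) := by
  have hinj : Function.Injective fun u : Fin (n + 2) → Fin d =>
      ((Fin.init u : Fin (n + 1) → Fin d), (Fin.tail u : Fin (n + 1) → Fin d)) := by
    intro u u' h
    simp only [Prod.mk.injEq] at h
    funext i
    refine Fin.cases ?_ (fun j => congrFun h.2 j) i
    exact congrFun h.1 0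
  have himage : ({p : (Fin (n + 1) → Fin d) × (Fin (n + 1) → Fin d) |
      ∀ i : Fin n, p.1 i.succ = p.2 i.castSucc} : Finset _) =
      univ.image fun u : Fin (n + 2) → Fin d =>
        ((Fin.init u : Fin (n + 1) → Fin d), (Fin.tail u : Fin (n + 1) → Fin d)) := by
    ext ⟨v, w⟩
    simp only [mem_filter, mem_univ, true_and, mem_image, Prod.mk.injEq]
    constructor
    · intro h
      refine ⟨Fin.cons (v 0) w, ?_, Fin.tail_cons _ _⟩
      funext i
      refine Fin.cases rfl (fun j => ?_) i
      exact (h j).symm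
    · rintro ⟨u, rfl, rfl⟩ i
      rfl
  rw [himage, card_image_of_injective _ hinj]
  simp

open Finset in
/-- A pair of words overlapping in both directions is determined by its two first letters. -/
theorem card_mutual_shift_pairs (n d : ℕ) :
    #{p : (Fin (n + 1) → Fin d) × (Fin (n + 1) → Fin d) |
      (∀ i : Fin n, p.1 i.succ = p.2 i.castSucc) ∧
        ∀ i : Fin n, p.2 i.succ = p.1 i.castSucc} = d ^ 2 := by
  let alt : Fin d × Fin d → (Fin (n + 1) → Fin d) × (Fin (n + 1) → Fin d) := fun q =>
    (fun i => if Even i.val then q.1 else q.2, fun i => if Even i.val then q.2 else q.1)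
  have hinj : Function.Injective alt := by
    rintro ⟨a, b⟩ ⟨a', b'⟩ h
    simp only [alt, Prod.mk.injEq] at h
    have h1 := congrFun h.1 0
    have h2 := congrFun h.2 0
    simp_all
  have himage : ({p : (Fin (n + 1) → Fin d) × (Fin (n + 1) → Fin d) |
      (∀ i : Fin n, p.1 i.succ = p.2 i.castSucc) ∧
        ∀ i : Fin n, p.2 i.succ = p.1 i.castSucc} : Finset _) = univ.image alt := by
    ext ⟨v, w⟩
    simp only [mem_filter, mem_univ, true_and, mem_image, alt, Prod.mk.injEq]
    constructor
    · rintro ⟨h, h'⟩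
      have key : ∀ i : Fin (n + 1), (if Even i.val then v 0 else w 0) = v i ∧
          (if Even i.val then w 0 else v 0) = w i := by
        intro i
        induction i using Fin.induction with
        | zero => simp
        | succ j ih =>
          rw [h j, h' j, ← ih.1, ← ih.2]
          simp only [Fin.val_succ, Fin.val_castSucc, Nat.even_add_one]
          split_ifs <;> simp_all
      exact ⟨(v 0, w 0), funext fun i => (key i).1, funext fun i => (key i).2⟩
    · rintro ⟨⟨a, b⟩, rfl, rfl⟩
      constructor <;> intro i <;>
        simp only [Fin.val_succ, Fin.val_castSucc, Nat.even_add_one] <;>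
        split_ifs <;> simp_all
  rw [himage, card_image_of_injective _ hinj]
  simp [sq]

open Finset in
/-- The words overlapping with themselves are the constant ones. -/
theorem card_shift_diag (n d : ℕ) :
    #{p : (Fin (n + 1) → Fin d) × (Fin (n + 1) → Fin d) |
      p.1 = p.2 ∧ ∀ i : Fin n, p.1 i.succ = p.2 i.castSucc} = d := by
  let const : Fin d → (Fin (n + 1) → Fin d) × (Fin (n + 1) → Fin d) := fun a =>
    (fun _ => a, fun _ => a)
  have hinj : Function.Injective const := fun a b h => congrFun (congrArg Prod.fst h) 0
  have himage : ({p : (Fin (n + 1) → Fin d) × (Fin (n + 1) → Fin d) |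
      p.1 = p.2 ∧ ∀ i : Fin n, p.1 i.succ = p.2 i.castSucc} : Finset _) =
      univ.image const := by
    ext ⟨v, w⟩
    simp only [mem_filter, mem_univ, true_and, mem_image, const, Prod.mk.injEq]
    constructor
    · rintro ⟨rfl, h⟩
      have key : ∀ i : Fin (n + 1), v 0 = v i := by
        intro i
        induction i using Fin.induction with
        | zero => rfl
        | succ j ih => rw [h j, ← ih]
      exact ⟨v 0, funext key, funext key⟩
    · rintro ⟨a, rfl, rfl⟩
      simp
  rw [himage, card_image_of_injective _ hinj]
  simp

theorem aoGraph_one_adj (n d : ℕ) (v w : Fin (n + 1) → Fin d) :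
    (AOGraph (n + 1) d 1).Adj v w ↔ v ≠ w ∧
      ((∀ i : Fin n, v i.succ = w i.castSucc) ∨ ∀ i : Fin n, w i.succ = v i.castSucc) := by
  have hsucc (i : Fin n) (h : 1 + i.val < n + 1) : (⟨1 + i.val, h⟩ : Fin (n + 1)) = i.succ :=
    Fin.ext (Nat.add_comm _ _)
  have hshift (v w : Fin (n + 1) → Fin d) :
      (∀ i : Fin (n + 1 - 1), v ⟨1 + i.val, by have := i.isLt; omega⟩
        = w ⟨i.val, by have := i.isLt; omega⟩) ↔ ∀ i : Fin n, v i.succ = w i.castSucc :=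
    forall_congr' fun i => by
      rw [hsucc i]
      rfl
  rw [AOGraph, SimpleGraph.fromRel_adj, hshift, hshift]

open Finset in
theorem two_mul_ncard_edgeSet_aoGraph_one (n d : ℕ) :
    2 * (AOGraph (n + 1) d 1).edgeSet.ncard + (d ^ 2 + d) = 2 * d ^ (n + 2) := by
  classical
  let R : Finset ((Fin (n + 1) → Fin d) × (Fin (n + 1) → Fin d)) :=
    {p | ∀ i : Fin n, p.1 i.succ = p.2 i.castSucc}
  let R' : Finset ((Fin (n + 1) → Fin d) × (Fin (n + 1) → Fin d)) :=
    {p | ∀ i : Fin n, p.2 i.succ = p.1 i.castSucc}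
  have hR : #R = d ^ (n + 2) := card_shift_pairs n d
  have hR' : #R' = d ^ (n + 2) := by
    rw [← hR]
    refine card_bij (fun p _ => p.swap) ?_ ?_ ?_
    · simp [R, R']
    · simp
    · intro p hp
      exact ⟨p.swap, by simpa [R, R'] using hp, by simp⟩
  have hinter : #(R ∩ R') = d ^ 2 := by
    rw [← card_mutual_shift_pairs n d, ← filter_and]
  have hdiag : #{p ∈ R ∪ R' | p.1 = p.2} = d := by
    conv_rhs => rw [← card_shift_diag n d]
    congr 1
    ext ⟨v, w⟩
    simp only [R, R', mem_filter, mem_union, mem_univ, true_and]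
    constructor
    · rintro ⟨h, rfl⟩
      exact ⟨rfl, h.elim id id⟩
    · rintro ⟨rfl, h⟩
      exact ⟨Or.inl h, rfl⟩
  have hadj : 2 * (AOGraph (n + 1) d 1).edgeSet.ncard = #{p ∈ R ∪ R' | ¬ p.1 = p.2} := by
    rw [← SimpleGraph.coe_edgeFinset, Set.ncard_coe_finset, SimpleGraph.two_mul_card_edgeFinset]
    congr 1
    ext ⟨v, w⟩
    simp only [R, R', mem_filter, mem_union, mem_univ, true_and, aoGraph_one_adj]
    exact and_comm
  have hsplit := card_filter_add_card_filter_not (s := R ∪ R') (fun p => p.1 = p.2)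
  have hunion := card_union_add_card_inter R R'
  omega

/-- For all `k ≥ 2` and `d ≥ 2`, the number of edges of `G(k, d, 1)` equals
`d^(k+1) - d(d+1)/2`. -/
theorem aoGraph_edge_count (k d : ℕ) (hk : 2 ≤ k) (hd : 2 ≤ d) :
    (AOGraph k d 1).edgeSet.ncard = d ^ (k + 1) - d * (d + 1) / 2 := by
  obtain ⟨n, rfl⟩ : ∃ n, k = n + 1 := ⟨k - 1, by omega⟩
  have h := two_mul_ncard_edgeSet_aoGraph_one n d
  have hd' : d * (d + 1) = d ^ 2 + d := by ring
  have heven := (Nat.even_mul_succ_self d).two_dvd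
  rw [show n + 1 + 1 = n + 2 from rfl]
  omega
end
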